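/- Let G be a finite simple graph on vertex set V and let S ⊆ V be a vertex cover of G (every edge of G has at least one endpoint in S), with V ∖ S nonempty. For each A ⊆ S let N_A = {v ∈ V ∖ S : N_G(v) = A}, let V′ ⊆ V ∖ S contain exactly one representative vertex from each nonempty class N_A, and let t = max{|N_A| : A ⊆ S, N_A ≠ ∅}. Then cub(G) ≤ cub(G[V′ ∪ S]) + ⌈log₂ t⌉, where G[V′ ∪ S] is the induced subgraph of G on V′ ∪ S. -/

import Mathlib

/-- A finite simple graph `H` is a unit interval graph if there is an assignment of
real unit intervals `[l v, l v + 1]` to the vertices such that distinct vertices are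
adjacent iff their intervals intersect. -/
def IsUnitIntervalGraph {V : Type*} (H : SimpleGraph V) : Prop :=
  ∃ l : V → ℝ,
    ∀ u v : V, u ≠ v →
      (H.Adj u v ↔ (Set.Icc (l u) (l u + 1) ∩ Set.Icc (l v) (l v + 1)).Nonempty)

/-- The cubicity of `G` : the least `k` such that `G` is the edge-intersection of
`k` unit interval graphs on the same vertex set. -/
noncomputable def cubicity {V : Type*} (G : SimpleGraph V) : ℕ :=
  sInf {k | ∃ I : Fin k → SimpleGraph V,
    (∀ i, IsUnitIntervalGraph (I i)) ∧ ∀ u v : V, G.Adj u v ↔ ∀ i, (I i).Adj u v}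

theorem Set.Icc_add_one_inter_nonempty_iff (a b : ℝ) :
    (Set.Icc a (a + 1) ∩ Set.Icc b (b + 1)).Nonempty ↔ |a - b| ≤ 1 := by
  rw [Set.Icc_inter_Icc, Set.nonempty_Icc, sup_le_iff, le_inf_iff, le_inf_iff, abs_le]
  constructor
  · rintro ⟨⟨_, h₁⟩, h₂, _⟩
    constructor <;> linarith
  · rintro ⟨h₁, h₂⟩
    refine ⟨⟨?_, ?_⟩, ?_, ?_⟩ <;> linarith

/-- A family of real-valued maps whose unit interval graphs intersect in `G`. -/
def IsCubeRepresentation {V ι : Type*} (G : SimpleGraph V) (l : ι → V → ℝ) : Prop :=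
  ∀ u v : V, G.Adj u v ↔ ∀ i, u ≠ v ∧ |l i u - l i v| ≤ 1

theorem IsCubeRepresentation.exists_isUnitIntervalGraph {V ι : Type*} [Fintype ι]
    {G : SimpleGraph V} {l : ι → V → ℝ} (h : IsCubeRepresentation G l) :
    ∃ I : Fin (Fintype.card ι) → SimpleGraph V,
      (∀ i, IsUnitIntervalGraph (I i)) ∧ ∀ u v : V, G.Adj u v ↔ ∀ i, (I i).Adj u v := by
  refine ⟨fun i =>
    { Adj := fun u v => u ≠ v ∧ |l ((Fintype.equivFin ι).symm i) u -
        l ((Fintype.equivFin ι).symm i) v| ≤ 1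
      symm := ⟨fun u v huv => ⟨huv.1.symm, by rw [abs_sub_comm]; exact huv.2⟩⟩
      loopless := ⟨fun u hu => hu.1 rfl⟩ }, fun i => ?_, fun u v => ?_⟩
  · refine ⟨l ((Fintype.equivFin ι).symm i), fun u v huv => ?_⟩
    rw [Set.Icc_add_one_inter_nonempty_iff]
    exact and_iff_right huv
  · rw [h u v]
    exact ((Fintype.equivFin ι).symm.forall_congr_right
      (q := fun i => u ≠ v ∧ |l i u - l i v| ≤ 1)).symm

theorem IsCubeRepresentation.cubicity_le {V ι : Type*} [Fintype ι] {G : SimpleGraph V}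
    {l : ι → V → ℝ} (h : IsCubeRepresentation G l) : cubicity G ≤ Fintype.card ι :=
  Nat.sInf_le h.exists_isUnitIntervalGraph

open Classical in
theorem exists_isCubeRepresentation {V : Type*} (G : SimpleGraph V) :
    ∃ l : V × V → V → ℝ, IsCubeRepresentation G l := by
  refine ⟨fun p w => if G.Adj p.1 p.2 then 0 else if w = p.1 then 0 else
    if w = p.2 then 2 else 1, fun u v => ⟨fun h p => ⟨h.ne, ?_⟩, fun h => ?_⟩⟩
  · have h' := h.symm
    have hne := h.ne
    dsimp only
    split_ifs <;> first | (norm_num; done) | simp_all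
  · by_contra hG
    obtain ⟨hne, hle⟩ := h (u, v)
    norm_num [hG, hne.symm] at hle

theorem exists_isCubeRepresentation_cubicity {V : Type*} [Finite V] (G : SimpleGraph V) :
    ∃ l : Fin (cubicity G) → V → ℝ, IsCubeRepresentation G l := by
  have := Fintype.ofFinite V
  obtain ⟨_, h⟩ := exists_isCubeRepresentation G
  obtain ⟨I, hI, hG⟩ := Nat.sInf_mem (s := {k | ∃ I : Fin k → SimpleGraph V,
    (∀ i, IsUnitIntervalGraph (I i)) ∧ ∀ u v : V, G.Adj u v ↔ ∀ i, (I i).Adj u v})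
    ⟨_, h.exists_isUnitIntervalGraph⟩
  choose l hl using hI
  refine ⟨l, fun u v => (hG u v).trans (forall_congr' fun i => ?_)⟩
  rw [← Set.Icc_add_one_inter_nonempty_iff]
  exact ⟨fun h => ⟨h.ne, (hl i u v h.ne).1 h⟩, fun h => (hl i u v h.1).2 h.2⟩

theorem Set.exists_injOn_bool_of_ncard_le {V : Type*} [Finite V] (s : Set V) {m : ℕ}
    (h : s.ncard ≤ 2 ^ m) : ∃ c : V → Fin m → Bool, Set.InjOn c s := by
  classical
  have := Fintype.ofFinite V
  obtain ⟨e⟩ : Nonempty (s ↪ (Fin m → Bool)) :=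
    Function.Embedding.nonempty_of_card_le (by
      rw [← Nat.card_eq_fintype_card, Nat.card_coe_set_eq]
      simpa using h)
  refine ⟨fun v => if hv : v ∈ s then e ⟨v, hv⟩ else fun _ => false, fun u hu v hv huv => ?_⟩
  simpa [hu, hv] using huv

open Classical in
/-- Pulling a representation back along a map identifying only twins outside a vertex cover,
and separating the twins by binary codes, gives a representation. -/
theorem IsCubeRepresentation.of_twins {V W ι : Type*} [Nonempty ι] {m : ℕ} {G : SimpleGraph V}
    {H : SimpleGraph W} {l : ι → W → ℝ} (hl : IsCubeRepresentation H l) {S : Set V}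
    (hcover : ∀ u v : V, G.Adj u v → u ∈ S ∨ v ∈ S) {r : V → W}
    (hr : ∀ u v, H.Adj (r u) (r v) ↔ G.Adj u v) {c : V → Fin m → Bool}
    (hc : ∀ u v, r u = r v → u ≠ v → u ∉ S ∧ v ∉ S ∧ c u ≠ c v) :
    IsCubeRepresentation G (Sum.elim (fun i v => l i (r v))
      (fun (j : Fin m) v => if v ∈ S then 1 else if c v j then 2 else 0)) := by
  refine fun u v => ⟨fun h => ?_, fun h => ?_⟩
  · rintro (i | j)
    · exact ⟨h.ne, ((hl _ _).1 ((hr u v).2 h) i).2⟩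
    · refine ⟨h.ne, ?_⟩
      have := hcover u v h
      simp only [Sum.elim_inr]
      split_ifs <;> first | (norm_num; done) | tauto
  · have hne : u ≠ v := (h (.inl (Classical.arbitrary ι))).1
    by_cases huv : r u = r v
    · obtain ⟨hu, hv, hcuv⟩ := hc u v huv hne
      obtain ⟨j, hj⟩ := Function.ne_iff.1 hcuv
      have hle := (h (.inr j)).2
      simp only [Sum.elim_inr, hu, hv, if_false] at hle
      cases hcu : c u j <;> cases hcv : c v j <;> simp_all
    · exact (hr u v).1 ((hl _ _).2 fun i => ⟨huv, (h (.inl i)).2⟩)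

/-- Let `S` be a vertex cover of `G` with `V \ S` nonempty, for `A ⊆ S` let
`N_A = {v ∈ V \ S : N_G(v) = A}`, let `V'` contain exactly one representative from
each nonempty class `N_A`, and let `t = max {|N_A| : A ⊆ S, N_A ≠ ∅}`. Then
`cub(G) ≤ cub(G[V' ∪ S]) + ⌈log₂ t⌉`. -/
theorem cubicity_le_cubicity_representatives_add_clog
    {V : Type*} [Fintype V] (G : SimpleGraph V) (S : Set V)
    (hcover : ∀ u v : V, G.Adj u v → u ∈ S ∨ v ∈ S)
    (hne : (Sᶜ : Set V).Nonempty)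
    (V' : Set V) (hV'sub : V' ⊆ Sᶜ)
    (hrep : ∀ A : Set V, A ⊆ S →
      {v : V | v ∉ S ∧ G.neighborSet v = A}.Nonempty →
      ∃! v : V, v ∈ V' ∩ {v : V | v ∉ S ∧ G.neighborSet v = A})
    (t : ℕ)
    (ht : IsGreatest {m : ℕ | ∃ A : Set V, A ⊆ S ∧
      {v : V | v ∉ S ∧ G.neighborSet v = A}.Nonempty ∧
      m = {v : V | v ∉ S ∧ G.neighborSet v = A}.ncard} t) :
    cubicity G ≤ cubicity (G.induce (V' ∪ S)) + Nat.clog 2 t := by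
  classical
  have hsub : ∀ v, v ∉ S → G.neighborSet v ⊆ S := fun v hv w hw =>
    (hcover v w hw).resolve_left hv
  have hrepr : ∀ v, ∃ w : ↥(V' ∪ S), (v ∈ S → (w : V) = v) ∧ (v ∉ S → (w : V) ∉ S) ∧
      G.neighborSet w = G.neighborSet v := by
    intro v
    by_cases hv : v ∈ S
    · exact ⟨⟨v, .inr hv⟩, fun _ => rfl, fun h => (h hv).elim, rfl⟩
    · obtain ⟨w, ⟨hw, hwS, hwN⟩, -⟩ := hrep _ (hsub v hv) ⟨v, hv, rfl⟩
      exact ⟨⟨w, .inl hw⟩, fun h => (hv h).elim, fun _ => hwS, hwN⟩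
  choose r hrS hrS' hrN using hrepr
  have hcode : ∀ A : Set V, ∃ c : V → Fin (Nat.clog 2 t) → Bool,
      Set.InjOn c {v : V | v ∉ S ∧ G.neighborSet v = A} := by
    intro A
    apply Set.exists_injOn_bool_of_ncard_le
    rcases Set.eq_empty_or_nonempty {v : V | v ∉ S ∧ G.neighborSet v = A} with h | h
    · simp [h]
    · have hA : A ⊆ S := by
        obtain ⟨v, hv, rfl⟩ := h
        exact hsub v hv
      exact (ht.2 ⟨A, hA, h, rfl⟩).trans (Nat.le_pow_clog one_lt_two t)
  choose c hc using hcode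
  obtain ⟨l, hl⟩ := exists_isCubeRepresentation_cubicity (G.induce (V' ∪ S))
  have : Nonempty (Fin (cubicity (G.induce (V' ∪ S)))) := by
    by_contra hempty
    rw [not_nonempty_iff] at hempty
    obtain ⟨v, -⟩ := hne
    exact ((hl (r v) (r v)).2 fun i => hempty.elim i).ne rfl
  have hrAdj : ∀ u v, (G.induce (V' ∪ S)).Adj (r u) (r v) ↔ G.Adj u v := by
    intro u v
    rw [SimpleGraph.induce_adj, ← SimpleGraph.mem_neighborSet, hrN, SimpleGraph.mem_neighborSet,
      G.adj_comm, ← SimpleGraph.mem_neighborSet, hrN, SimpleGraph.mem_neighborSet, G.adj_comm]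
  have hG := hl.of_twins hcover hrAdj (c := fun v => c (G.neighborSet v) v) fun u v huv hne => by
    have hu : u ∉ S := by
      intro hu
      by_cases hv : v ∈ S
      · exact hne (by rw [← hrS u hu, huv, hrS v hv])
      · exact hrS' v hv (by rwa [← huv, hrS u hu])
    have hv : v ∉ S := by
      intro hv
      exact hrS' u hu (by rwa [huv, hrS v hv])
    have hN : G.neighborSet u = G.neighborSet v := by rw [← hrN u, huv, hrN v]
    refine ⟨hu, hv, fun hcuv => hne (hc (G.neighborSet v) ⟨hu, hN⟩ ⟨hv, rfl⟩ ?_)⟩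
    simpa only [hN] using hcuv
  simpa using hG.cubicity_le
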